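/- arXiv:math/0002066 — 2 statements merged into one kernel-verified Lean document; each statement's English description precedes it below -/
import Mathlib

section
/- In V = F_3^5 with quadratic form q(a) = a_0^2 - a_1^2 - ... - a_4^2, the orthogonal complement of the long vector a = (1,0,0,0,0) contains exactly 12 antipodal pairs {±v} of vectors of norm -1 (short vectors), and these 12 pairs decompose in a unique way into three sets of 4 pairs that are pairwise orthogonal. -/
abbrev V : Type := Fin 5 → ZMod 3

def q (a : V) : ZMod 3 := a 0 ^ 2 - a 1 ^ 2 - a 2 ^ 2 - a 3 ^ 2 - a 4 ^ 2

def b (x y : V) : ZMod 3 := x 0 * y 0 - x 1 * y 1 - x 2 * y 2 - x 3 * y 3 - x 4 * y 4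

def e0 : V := fun i => if i = 0 then 1 else 0

def pairOf (v : V) : Finset V := {v, -v}

def orthPairs (s t : Finset V) : Prop := ∀ u ∈ s, ∀ w ∈ t, b u w = 0

def shortPairs : Finset (Finset V) :=
  (Finset.univ.filter fun v : V => q v = -1 ∧ b e0 v = 0).image pairOf

instance (s t : Finset V) : Decidable (orthPairs s t) := by
  unfold orthPairs; infer_instance

/-- One vector from each of the twelve short pairs orthogonal to `e0`, frame by frame. -/
def shortRep : Fin 12 → V :=
  ![![0, 1, 0, 0, 0], ![0, 0, 1, 0, 0], ![0, 0, 0, 1, 0], ![0, 0, 0, 0, 1],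
    ![0, 1, 1, 1, 1], ![0, 1, 1, 2, 2], ![0, 1, 2, 1, 2], ![0, 1, 2, 2, 1],
    ![0, 1, 1, 1, 2], ![0, 1, 1, 2, 1], ![0, 1, 2, 1, 1], ![0, 1, 2, 2, 2]]

theorem shortPairs_eq_image : shortPairs = Finset.univ.image fun i => pairOf (shortRep i) := by
  decide +kernel

theorem pairOf_shortRep_injective : Function.Injective fun i => pairOf (shortRep i) := by
  unfold Function.Injective
  decide +kernel

theorem orthPairs_pairOf_shortRep : ∀ i j, pairOf (shortRep i) = pairOf (shortRep j) ∨
    orthPairs (pairOf (shortRep i)) (pairOf (shortRep j)) ↔ i.val / 4 = j.val / 4 := by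
  decide +kernel

theorem card_shortPairs : shortPairs.card = 12 := by
  rw [shortPairs_eq_image, Finset.card_image_of_injective _ pairOf_shortRep_injective]
  rfl

/-- The short pairs equal or orthogonal to `p`. -/
def orthClass (p : Finset V) : Finset (Finset V) :=
  shortPairs.filter fun p' => p = p' ∨ orthPairs p p'

theorem orthClass_pairOf_shortRep (i : Fin 12) : orthClass (pairOf (shortRep i)) =
    (Finset.univ.filter fun j : Fin 12 => i.val / 4 = j.val / 4).image
      fun j => pairOf (shortRep j) := by
  simp only [orthClass, shortPairs_eq_image, Finset.filter_image, orthPairs_pairOf_shortRep]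

theorem exists_eq_pairOf_shortRep {p : Finset V} (hp : p ∈ shortPairs) :
    ∃ i, pairOf (shortRep i) = p := by
  simpa [shortPairs_eq_image] using hp

theorem card_orthClass (p : Finset V) (hp : p ∈ shortPairs) : (orthClass p).card = 4 := by
  obtain ⟨i, rfl⟩ := exists_eq_pairOf_shortRep hp
  rw [orthClass_pairOf_shortRep, Finset.card_image_of_injective _ pairOf_shortRep_injective]
  revert i
  decide

theorem card_image_orthClass : (shortPairs.image orthClass).card = 3 := by
  have h : orthClass ∘ (fun i => pairOf (shortRep i)) =
      (Finset.image fun j => pairOf (shortRep j)) ∘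
        fun i : Fin 12 => Finset.univ.filter fun j : Fin 12 => i.val / 4 = j.val / 4 :=
    funext orthClass_pairOf_shortRep
  rw [shortPairs_eq_image, Finset.image_image, h, ← Finset.image_image,
    Finset.card_image_of_injective _ (Finset.image_injective pairOf_shortRep_injective)]
  decide

theorem orthPairs_of_mem_orthClass (r : Finset V) (hr : r ∈ shortPairs) : ∀ p ∈ orthClass r,
    ∀ p' ∈ orthClass r, p ≠ p' → orthPairs p p' := by
  obtain ⟨i, rfl⟩ := exists_eq_pairOf_shortRep hr
  simp only [orthClass_pairOf_shortRep, Finset.mem_image, Finset.mem_filter, Finset.mem_univ,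
    true_and]
  rintro _ ⟨j, hj, rfl⟩ _ ⟨k, hk, rfl⟩ hne
  exact ((orthPairs_pairOf_shortRep j k).2 (hj.symm.trans hk)).resolve_left hne

theorem mem_orthClass_self {p : Finset V} (hp : p ∈ shortPairs) : p ∈ orthClass p :=
  Finset.mem_filter.2 ⟨hp, Or.inl rfl⟩

/-- An orthogonal frame of four short pairs is the class of each of its members. -/
theorem eq_orthClass {s : Finset (Finset V)} (hcard : s.card = 4)
    (hsub : ∀ p ∈ s, p ∈ shortPairs)
    (horth : ∀ p ∈ s, ∀ p' ∈ s, p ≠ p' → orthPairs p p') {p : Finset V} (hp : p ∈ s) :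
    s = orthClass p := by
  refine Finset.eq_of_subset_of_card_le (fun p' hp' => ?_) ?_
  · refine Finset.mem_filter.2 ⟨hsub p' hp', ?_⟩
    by_cases h : p = p'
    · exact Or.inl h
    · exact Or.inr (horth p hp p' hp' h)
  · rw [hcard, card_orthClass p (hsub p hp)]

theorem stmt6 :
    shortPairs.card = 12 ∧
    ∃! T : Finset (Finset (Finset V)),
      T.card = 3 ∧
      (∀ s ∈ T, s.card = 4 ∧ (∀ p ∈ s, p ∈ shortPairs) ∧
        ∀ p ∈ s, ∀ p' ∈ s, p ≠ p' → orthPairs p p') ∧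
      ∀ p ∈ shortPairs, ∃ s ∈ T, p ∈ s := by
  refine ⟨card_shortPairs, shortPairs.image orthClass, ⟨card_image_orthClass, ?_, ?_⟩, ?_⟩
  · intro s hs
    obtain ⟨r, hr, rfl⟩ := Finset.mem_image.1 hs
    exact ⟨card_orthClass r hr, fun p hp => (Finset.mem_filter.1 hp).1,
      orthPairs_of_mem_orthClass r hr⟩
  · exact fun p hp => ⟨orthClass p, Finset.mem_image_of_mem _ hp, mem_orthClass_self hp⟩
  · rintro T ⟨-, hT, hcover⟩
    ext s
    rw [Finset.mem_image]
    constructor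
    · intro hs
      obtain ⟨hcard, hsub, horth⟩ := hT s hs
      obtain ⟨p, hp⟩ := Finset.card_pos.1 (by omega : 0 < s.card)
      exact ⟨p, hsub p hp, (eq_orthClass hcard hsub horth hp).symm⟩
    · rintro ⟨p, hp, rfl⟩
      obtain ⟨s, hs, hps⟩ := hcover p hp
      obtain ⟨hcard, hsub, horth⟩ := hT s hs
      rwa [← eq_orthClass hcard hsub horth hps]
end

section
/- In V = F_3^5 with the quadratic form q(a) = a_0^2 - a_1^2 - ... - a_4^2, there are exactly 135 crosses, where a cross is a set of 5 pairwise orthogonal antipodal pairs {±a_0},...,{±a_4} with a_0 of norm 1 and a_1,...,a_4 of norm -1. Each of the 45 antipodal pairs of long vectors is contained in exactly 3 crosses. -/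
def IsLongPair (p : Finset V) : Prop := ∃ v : V, q v = 1 ∧ p = {v, -v}

def IsShortPair (p : Finset V) : Prop := ∃ v : V, q v = -1 ∧ p = {v, -v}

def IsCross (c : Finset (Finset V)) : Prop :=
  c.card = 5 ∧ (∀ p ∈ c, ∀ p' ∈ c, p ≠ p' → orthPairs p p') ∧
  ∃ p ∈ c, IsLongPair p ∧ ∀ p' ∈ c, p' ≠ p → IsShortPair p'

theorem b_self (v : V) : b v v = q v := by simp only [b, q]; ring

theorem b_neg_left (u v : V) : b (-u) v = -b u v := by simp only [b, Pi.neg_apply]; ring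

theorem b_neg_right (u v : V) : b u (-v) = -b u v := by simp only [b, Pi.neg_apply]; ring

theorem q_neg (v : V) : q (-v) = q v := by simp only [q, Pi.neg_apply]; ring

def antipodal (v : V) : Finset V := {v, -v}

theorem self_mem_antipodal (v : V) : v ∈ antipodal v := by simp [antipodal]

theorem antipodal_neg (v : V) : antipodal (-v) = antipodal v := by
  simp [antipodal, Finset.pair_comm]

theorem antipodal_eq_iff {u v : V} : antipodal u = antipodal v ↔ u = v ∨ u = -v := by
  refine ⟨fun h => ?_, ?_⟩
  · have := self_mem_antipodal u
    rw [h] at this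
    simpa [antipodal] using this
  · rintro (rfl | rfl)
    exacts [rfl, antipodal_neg v]

theorem orthPairs_antipodal {u v : V} : orthPairs (antipodal u) (antipodal v) ↔ b u v = 0 := by
  simp [orthPairs, antipodal, b_neg_left, b_neg_right]

theorem isLongPair_iff {p : Finset V} : IsLongPair p ↔ ∃ v, q v = 1 ∧ p = antipodal v := Iff.rfl

theorem isShortPair_iff {p : Finset V} : IsShortPair p ↔ ∃ v, q v = -1 ∧ p = antipodal v := Iff.rfl

theorem IsLongPair.not_isShortPair {p : Finset V} (h : IsLongPair p) : ¬ IsShortPair p := by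
  rw [isShortPair_iff]
  rintro ⟨w, hw, rfl⟩
  obtain ⟨v, hv, h⟩ := isLongPair_iff.1 h
  have : q w = q v := by
    rcases antipodal_eq_iff.1 h with rfl | rfl
    · rfl
    · exact q_neg v
  rw [hv, hw] at this
  exact absurd this (by decide)

theorem IsCross.existsUnique_isLongPair {c : Finset (Finset V)} (h : IsCross c) :
    ∃! p, IsLongPair p ∧ p ∈ c := by
  obtain ⟨-, -, p, hp, hl, hs⟩ := h
  refine ⟨p, ⟨hl, hp⟩, fun p' ⟨hl', hp'⟩ => ?_⟩
  by_contra hne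
  exact hl'.not_isShortPair (hs p' hp' hne)

section Isometry

variable {e : V ≃ V}

theorem finsetCongr_antipodal (hn : ∀ x, e (-x) = -e x) (v : V) :
    e.finsetCongr (antipodal v) = antipodal (e v) := by
  simp [antipodal, hn]

theorem IsCross.finsetCongr (hb : ∀ x y, b (e x) (e y) = b x y) (hn : ∀ x, e (-x) = -e x)
    {c : Finset (Finset V)} (h : IsCross c) : IsCross (e.finsetCongr.finsetCongr c) := by
  have hq (v : V) : q (e v) = q v := by rw [← b_self, hb, b_self]
  obtain ⟨hcard, horth, p, hp, ⟨v, hv, rfl⟩, hs⟩ := h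
  refine ⟨by simpa using hcard, ?_, e.finsetCongr (antipodal v), ?_, ?_, ?_⟩
  · simp only [Equiv.finsetCongr_apply, Finset.mem_map, Equiv.coe_toEmbedding]
    rintro _ ⟨r, hr, rfl⟩ _ ⟨s, hs', rfl⟩ hne x hx y hy
    obtain ⟨x, hxr, rfl⟩ := Finset.mem_map.1 hx
    obtain ⟨y, hys, rfl⟩ := Finset.mem_map.1 hy
    exact (hb x y).trans (horth r hr s hs' (fun hrs => hne (by rw [hrs])) x hxr y hys)
  · exact Finset.mem_map_of_mem _ hp
  · exact ⟨e v, (hq v).trans hv, finsetCongr_antipodal hn v⟩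
  · intro p' hp' hne
    obtain ⟨r, hr, rfl⟩ := Finset.mem_map.1 hp'
    obtain ⟨w, hw, rfl⟩ := hs r hr fun hrv => hne (by rw [hrv]; rfl)
    exact ⟨e w, (hq w).trans hw, finsetCongr_antipodal hn w⟩

theorem isCross_finsetCongr_iff (hb : ∀ x y, b (e x) (e y) = b x y) (hn : ∀ x, e (-x) = -e x)
    {c : Finset (Finset V)} : IsCross (e.finsetCongr.finsetCongr c) ↔ IsCross c := by
  refine ⟨fun h => ?_, fun h => h.finsetCongr hb hn⟩
  have hb' (x y : V) : b (e.symm x) (e.symm y) = b x y := by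
    rw [← hb, e.apply_symm_apply, e.apply_symm_apply]
  have hn' (x : V) : e.symm (-x) = -e.symm x := by
    rw [e.symm_apply_eq, hn, e.apply_symm_apply]
  have := h.finsetCongr hb' hn'
  rwa [← Equiv.finsetCongr_symm, ← Equiv.finsetCongr_symm, Equiv.symm_apply_apply] at this

theorem card_crosses_through_apply (hb : ∀ x y, b (e x) (e y) = b x y)
    (hn : ∀ x, e (-x) = -e x) (v : V) :
    Nat.card {c : Finset (Finset V) // IsCross c ∧ antipodal v ∈ c} =
      Nat.card {c : Finset (Finset V) // IsCross c ∧ antipodal (e v) ∈ c} := by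
  refine Nat.card_congr (e.finsetCongr.finsetCongr.subtypeEquiv fun c => ?_)
  rw [isCross_finsetCongr_iff hb hn, ← finsetCongr_antipodal hn, Equiv.finsetCongr_apply,
    ← Equiv.coe_toEmbedding, Finset.mem_map']

end Isometry

/-- The reflection in a vector `u` with `q u ≠ 0`; over `ZMod 3`, `-2 / q u = q u`. -/
def reflect (u x : V) : V := x + (q u * b x u) • u

theorem b_reflect {u : V} (hu : q u ≠ 0) (x y : V) : b (reflect u x) (reflect u y) = b x y := by
  have hexp : b (reflect u x) (reflect u y) =
      b x y + b x u * b y u * q u * (2 + q u ^ 2) := by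
    simp only [reflect, ← b_self u]
    simp only [b, Pi.add_apply, Pi.smul_apply, smul_eq_mul]
    ring
  have h2 : ∀ t : ZMod 3, t ≠ 0 → 2 + t ^ 2 = 0 := by decide
  rw [hexp, h2 _ hu, mul_zero, add_zero]

theorem reflect_involutive {u : V} (hu : q u ≠ 0) : Function.Involutive (reflect u) := by
  intro x
  have hexp : reflect u (reflect u x) = x + (b x u * q u * (2 + q u ^ 2)) • u := by
    ext i
    simp only [reflect, ← b_self u]
    simp only [b, Pi.add_apply, Pi.smul_apply, smul_eq_mul]
    ring
  have h2 : ∀ t : ZMod 3, t ≠ 0 → 2 + t ^ 2 = 0 := by decide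
  rw [hexp, h2 _ hu, mul_zero, zero_smul, add_zero]

theorem reflect_neg (u x : V) : reflect u (-x) = -reflect u x := by
  simp only [reflect, b_neg_left, mul_neg, neg_smul, neg_add]

def e₀ : V := ![1, 0, 0, 0, 0]

theorem b_e₀ (v : V) : b e₀ v = v 0 := by simp [b, e₀]

/-- A suitable reflection takes any long pair to that of `e₀`. -/
theorem exists_reflect_antipodal {v : V} (hv : q v = 1) :
    ∃ u, q u ≠ 0 ∧ antipodal (reflect u v) = antipodal e₀ := by
  have hsub : q (v - e₀) = q v + 1 - 2 * v 0 := by simp [q, e₀]; ring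
  have hadd : q (v + e₀) = q v + 1 + 2 * v 0 := by simp [q, e₀]; ring
  have bsub : b v (v - e₀) = q v - v 0 := by simp [q, b, e₀]; ring
  have badd : b v (v + e₀) = q v + v 0 := by simp [q, b, e₀]; ring
  have key : ∀ t : ZMod 3, (1 + 1 - 2 * t ≠ 0 ∧ (1 + 1 - 2 * t) * (1 - t) = -1) ∨
      (1 + 1 + 2 * t ≠ 0 ∧ (1 + 1 + 2 * t) * (1 + t) = -1) := by decide
  rcases key (v 0) with ⟨h, h'⟩ | ⟨h, h'⟩
  · refine ⟨v - e₀, by rwa [hsub, hv], ?_⟩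
    rw [reflect, hsub, bsub, hv, h']
    congr 1
    module
  · refine ⟨v + e₀, by rwa [hadd, hv], ?_⟩
    rw [reflect, hadd, badd, hv, h', ← antipodal_neg]
    congr 1
    module

/-- The short vectors orthogonal to `e₀` with prescribed product of the last four coordinates. -/
def shortClass (k : ZMod 3) : Finset V :=
  {x | x 0 = 0 ∧ q x = -1 ∧ x 1 * x 2 * x 3 * x 4 = k}

def standardCross (k : ZMod 3) : Finset (Finset V) :=
  insert (antipodal e₀) ((shortClass k).image antipodal)

theorem card_standardCross (k : ZMod 3) : (standardCross k).card = 5 := by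
  revert k
  decide +kernel

/-- Distinct short pairs orthogonal to `e₀` are orthogonal exactly when they have the same
product of coordinates. -/
theorem orthogonal_iff_prod_eq {x y : V} (hx₀ : x 0 = 0) (hy₀ : y 0 = 0) (hx : q x = -1)
    (hy : q y = -1) (hne : antipodal x ≠ antipodal y) :
    b x y = 0 ↔ x 1 * x 2 * x 3 * x 4 = y 1 * y 2 * y 3 * y 4 := by
  have hne₁ : x ≠ y := by rintro rfl; exact hne rfl
  have hne₂ : x ≠ -y := by rintro rfl; exact hne (antipodal_neg y)
  clear hne
  have key : ∀ x₁ x₂ x₃ x₄ : Fin 3, x₁ * x₁ + x₂ * x₂ + x₃ * x₃ + x₄ * x₄ = 1 →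
      ∀ y₁ y₂ y₃ y₄ : Fin 3, y₁ * y₁ + y₂ * y₂ + y₃ * y₃ + y₄ * y₄ = 1 →
      ¬ (x₁ = y₁ ∧ x₂ = y₂ ∧ x₃ = y₃ ∧ x₄ = y₄) →
      ¬ (x₁ = -y₁ ∧ x₂ = -y₂ ∧ x₃ = -y₃ ∧ x₄ = -y₄) →
      (x₁ * y₁ + x₂ * y₂ + x₃ * y₃ + x₄ * y₄ = 0 ↔ x₁ * x₂ * x₃ * x₄ = y₁ * y₂ * y₃ * y₄) := by
    decide +kernel
  have hsum {z : V} (h₀ : z 0 = 0) (h : q z = -1) :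
      z 1 * z 1 + z 2 * z 2 + z 3 * z 3 + z 4 * z 4 = 1 := by
    simp only [q, h₀] at h
    linear_combination -h
  have hb : b x y = -(x 1 * y 1 + x 2 * y 2 + x 3 * y 3 + x 4 * y 4) := by
    simp only [b, hx₀]
    ring
  rw [hb, neg_eq_zero]
  refine key (x 1) (x 2) (x 3) (x 4) (hsum hx₀ hx) (y 1) (y 2) (y 3) (y 4) (hsum hy₀ hy) ?_ ?_
  · rintro ⟨h₁, h₂, h₃, h₄⟩
    exact hne₁ (funext (Fin.forall_fin_succ.2 ⟨hx₀.trans hy₀.symm, by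
      simpa [Fin.forall_fin_succ] using ⟨h₁, h₂, h₃, h₄⟩⟩))
  · rintro ⟨h₁, h₂, h₃, h₄⟩
    exact hne₂ (funext (Fin.forall_fin_succ.2 ⟨by simp [hx₀, hy₀], by
      simpa [Fin.forall_fin_succ] using ⟨h₁, h₂, h₃, h₄⟩⟩))

theorem q_e₀ : q e₀ = 1 := by simp [q, e₀]

theorem mem_standardCross {k : ZMod 3} {p : Finset V} :
    p ∈ standardCross k ↔ p = antipodal e₀ ∨
      ∃ x : V, (x 0 = 0 ∧ q x = -1 ∧ x 1 * x 2 * x 3 * x 4 = k) ∧ antipodal x = p := by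
  simp [standardCross, shortClass]

theorem isCross_standardCross (k : ZMod 3) : IsCross (standardCross k) := by
  refine ⟨card_standardCross k, fun p hp p' hp' hne => ?_, antipodal e₀, ?_, ⟨e₀, q_e₀, rfl⟩, ?_⟩
  · rw [mem_standardCross] at hp hp'
    obtain rfl | ⟨x, ⟨hx₀, hx, hxk⟩, rfl⟩ := hp <;> obtain rfl | ⟨y, ⟨hy₀, hy, hyk⟩, rfl⟩ := hp'
    · exact absurd rfl hne
    · rwa [orthPairs_antipodal, b_e₀]
    · rw [orthPairs_antipodal]
      simpa [b, e₀] using hx₀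
    · rw [orthPairs_antipodal, orthogonal_iff_prod_eq hx₀ hy₀ hx hy hne, hxk, hyk]
  · simp [mem_standardCross]
  · intro p hp hne
    obtain rfl | ⟨x, ⟨-, hx, -⟩, rfl⟩ := mem_standardCross.1 hp
    · exact absurd rfl hne
    · exact ⟨x, hx, rfl⟩

theorem IsCross.exists_eq_standardCross {c : Finset (Finset V)} (h : IsCross c)
    (he : antipodal e₀ ∈ c) : ∃ k, standardCross k = c := by
  have hlong : IsLongPair (antipodal e₀) := ⟨e₀, q_e₀, rfl⟩
  have huniq := h.existsUnique_isLongPair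
  obtain ⟨hcard, horth, p, hp, hl, hs⟩ := h
  obtain rfl := huniq.unique ⟨hlong, he⟩ ⟨hl, hp⟩
  have hshort : ∀ r ∈ c, r ≠ antipodal e₀ → ∃ x : V, x 0 = 0 ∧ q x = -1 ∧ r = antipodal x := by
    intro r hr hne
    obtain ⟨x, hx, rfl⟩ := isShortPair_iff.1 (hs r hr hne)
    refine ⟨x, ?_, hx, rfl⟩
    rw [← b_e₀ x, ← orthPairs_antipodal]
    exact horth _ he _ hr hne.symm
  obtain ⟨r, hr, hne⟩ := Finset.exists_mem_ne (by omega : 1 < c.card) (antipodal e₀)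
  obtain ⟨x, hx₀, hx, rfl⟩ := hshort r hr hne
  refine ⟨x 1 * x 2 * x 3 * x 4, (Finset.eq_of_subset_of_card_le (fun s hs' => ?_) ?_).symm⟩
  · rw [mem_standardCross]
    by_cases hse : s = antipodal e₀
    · exact Or.inl hse
    · obtain ⟨y, hy₀, hy, rfl⟩ := hshort s hs' hse
      refine Or.inr ⟨y, ⟨hy₀, hy, ?_⟩, rfl⟩
      by_cases hxy : antipodal y = antipodal x
      · rcases antipodal_eq_iff.1 hxy with rfl | rfl
        · rfl
        · simp
      · rw [← orthogonal_iff_prod_eq hy₀ hx₀ hy hx hxy, ← orthPairs_antipodal]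
        exact horth _ hs' _ hr hxy
  · rw [card_standardCross, hcard]

theorem standardCross_injective : Function.Injective standardCross := by
  decide +kernel

theorem card_crosses_through_e₀ :
    Nat.card {c : Finset (Finset V) // IsCross c ∧ antipodal e₀ ∈ c} = 3 := by
  rw [← Nat.card_zmod 3]
  refine (Nat.card_eq_of_bijective (fun k => ⟨standardCross k, isCross_standardCross k,
    by simp [mem_standardCross]⟩) ⟨fun k l hkl => ?_, fun ⟨c, hc, he⟩ => ?_⟩).symm
  · exact standardCross_injective (congrArg Subtype.val hkl)
  · obtain ⟨k, rfl⟩ := hc.exists_eq_standardCross he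
    exact ⟨k, rfl⟩

theorem IsLongPair.card_crosses {p : Finset V} (hp : IsLongPair p) :
    Nat.card {c : Finset (Finset V) // IsCross c ∧ p ∈ c} = 3 := by
  obtain ⟨v, hv, rfl⟩ := isLongPair_iff.1 hp
  obtain ⟨u, hu, h⟩ := exists_reflect_antipodal hv
  rw [card_crosses_through_apply (e := (reflect_involutive hu).toPerm) (b_reflect hu)
    (reflect_neg u), Function.Involutive.coe_toPerm, h, card_crosses_through_e₀]

theorem card_long : ({v | q v = 1} : Finset V).card = 90 := by decide +kernel

theorem card_antipodal {v : V} (hv : q v = 1) : (antipodal v).card = 2 := by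
  refine Finset.card_pair fun h => ?_
  have h' := b_neg_right v v
  rw [← h, b_self, hv] at h'
  exact absurd h' (by decide)

theorem card_longPairs : Nat.card {p : Finset V // IsLongPair p} = 45 := by
  have h : (({v | q v = 1} : Finset V).image antipodal).card = 45 := by
    have hsum := Finset.card_eq_sum_card_image antipodal ({v | q v = 1} : Finset V)
    rw [card_long, Finset.sum_const_nat (m := 2)] at hsum
    · omega
    · simp only [Finset.mem_image, Finset.mem_filter_univ]
      rintro _ ⟨v, hv, rfl⟩
      refine (congrArg Finset.card (Finset.ext fun u => ?_)).trans (card_antipodal hv)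
      rw [Finset.mem_filter, Finset.mem_filter_univ, antipodal_eq_iff, antipodal,
        Finset.mem_insert, Finset.mem_singleton, and_iff_right_iff_imp]
      rintro (rfl | rfl)
      exacts [hv, (q_neg v).trans hv]
  rw [← h]
  refine Nat.subtype_card _ fun p => ?_
  simp [isLongPair_iff, eq_comm]

/-- A cross is the same as a long pair together with a cross through it. -/
noncomputable def crossEquivSigma : {c : Finset (Finset V) // IsCross c} ≃
    Σ p : {p : Finset V // IsLongPair p}, {c : Finset (Finset V) // IsCross c ∧ p.1 ∈ c} where
  toFun c := ⟨⟨c.2.existsUnique_isLongPair.choose, c.2.existsUnique_isLongPair.choose_spec.1.1⟩,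
    c.1, c.2, c.2.existsUnique_isLongPair.choose_spec.1.2⟩
  invFun s := ⟨s.2.1, s.2.2.1⟩
  left_inv _ := rfl
  right_inv := by
    rintro ⟨⟨p, hp⟩, c, hc, hpc⟩
    obtain rfl := hc.existsUnique_isLongPair.choose_spec.2 p ⟨hp, hpc⟩
    rfl

theorem stmt8 :
    Nat.card {c : Finset (Finset V) // IsCross c} = 135 ∧
    Nat.card {p : Finset V // IsLongPair p} = 45 ∧
    ∀ p : Finset V, IsLongPair p →
      Nat.card {c : Finset (Finset V) // IsCross c ∧ p ∈ c} = 3 := by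
  refine ⟨?_, card_longPairs, fun p hp => hp.card_crosses⟩
  have := Fintype.ofFinite {p : Finset V // IsLongPair p}
  rw [Nat.card_congr crossEquivSigma, Nat.card_sigma,
    Finset.sum_congr rfl fun p _ => p.2.card_crosses, Finset.sum_const, Finset.card_univ,
    ← Nat.card_eq_fintype_card, card_longPairs]
  rfl
end
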